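/- arXiv:2109.01308 — 2 statements merged into one kernel-verified Lean document; each statement's English description precedes it below -/
import Mathlib

section
/- Let m ≥ 2, n = 2, α ∈ ℝ, and let Π^α be the contract function Π^α_i(P; j) = s_qu(p_i; j) − (m−1)² s_qu(p̄_{−i}; j) + α p̄_{−i,j}. Fix a coalition C ⊆ [m] with |C| ≥ 2 and an outcome j ∈ {1,2}. If P, Q ∈ (Δ_2)^m satisfy p_i = q_i for all i ∉ C and p_{C,j} = q_{C,j}, then Σ_{i∈C} Π^α_i(P; j) = Σ_{i∈C} Π^α_i(Q; j). That is, holding fixed the reports of experts outside C, the coalition's total reward under outcome j depends only on the sum p_{C,j} of the coalition members' reported probabilities of outcome j. -/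
open Finset

/-- Brier's quadratic scoring rule: `s_qu(p; j) = 1 - (1 - p j)^2 - ∑_{l ≠ j} (p l)^2`. -/
noncomputable def squ {n : ℕ} (p : Fin n → ℝ) (j : Fin n) : ℝ :=
  1 - (1 - p j) ^ 2 - ∑ l ∈ ({j}ᶜ : Finset (Fin n)), (p l) ^ 2

/-- The average report `p̄_{-i}` of all experts except `i`. -/
noncomputable def avgExcept {m n : ℕ} (P : Fin m → Fin n → ℝ) (i : Fin m) : Fin n → ℝ :=
  fun j => (1 / ((m : ℝ) - 1)) * ∑ k ∈ ({i}ᶜ : Finset (Fin m)), P k j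

/-- The contract function `Π^α_i(P; j) = s_qu(p_i; j) - (m-1)^2 s_qu(p̄_{-i}; j) + α p̄_{-i,j}`. -/
noncomputable def piAlpha {m n : ℕ} (α : ℝ) (P : Fin m → Fin n → ℝ) (i : Fin m) (j : Fin n) : ℝ :=
  squ (P i) j - ((m : ℝ) - 1) ^ 2 * squ (avgExcept P i) j + α * avgExcept P i j

/-- A tuple of reports, one probability distribution in the simplex `Δ_n` per expert. -/
def IsSimplexTuple {m n : ℕ} (P : Fin m → Fin n → ℝ) : Prop :=
  ∀ k, P k ∈ stdSimplex ℝ (Fin n)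

/-- For two outcomes the quadratic score of a vector summing to `1` depends only on the
coordinate of the realised outcome. -/
lemma squ_two_of_sum_eq_one {p : Fin 2 → ℝ} (hp : ∑ l, p l = 1) (j : Fin 2) :
    squ p j = 1 - 2 * (1 - p j) ^ 2 := by
  have hc : ∑ l ∈ ({j}ᶜ : Finset (Fin 2)), p l ^ 2 = (1 - p j) ^ 2 := by
    rw [Fin.sum_univ_two] at hp
    have h := Finset.sum_compl_add_sum ({j} : Finset (Fin 2)) fun l => p l ^ 2
    rw [Finset.sum_singleton, Fin.sum_univ_two] at h
    fin_cases j <;> simp only [Fin.zero_eta, Fin.mk_one] at h ⊢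
    · rw [← hp]
      linear_combination h
    · rw [← hp]
      linear_combination h
  rw [squ, hc]
  ring

lemma avgExcept_eq {m n : ℕ} (P : Fin m → Fin n → ℝ) (i : Fin m) (j : Fin n) :
    avgExcept P i j = (∑ k, P k j - P i j) / ((m : ℝ) - 1) := by
  have h := Finset.sum_compl_add_sum ({i} : Finset (Fin m)) fun k => P k j
  rw [Finset.sum_singleton] at h
  rw [avgExcept, ← h]
  ring

lemma sum_avgExcept {m n : ℕ} (hm : 2 ≤ m) {P : Fin m → Fin n → ℝ} (hP : IsSimplexTuple P)
    (i : Fin m) : ∑ j, avgExcept P i j = 1 := by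
  have hm' : (2 : ℝ) ≤ m := by exact_mod_cast hm
  have hne : (m : ℝ) - 1 ≠ 0 := by linarith
  simp only [avgExcept_eq]
  rw [← Finset.sum_div, Finset.sum_sub_distrib, Finset.sum_comm]
  simp [fun k => (hP k).2, hne]

/-- For two outcomes, the reward of an expert is affine in the expert's own report once the
sum of all reports is fixed. -/
lemma piAlpha_two_eq {m : ℕ} (hm : 2 ≤ m) (α : ℝ) {P : Fin m → Fin 2 → ℝ}
    (hP : IsSimplexTuple P) (i : Fin m) (j : Fin 2) :
    piAlpha α P i j =
      (2 * ((m : ℝ) - 1 - ∑ k, P k j) ^ 2 - 1 - ((m : ℝ) - 1) ^ 2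
          + α * (∑ k, P k j) / ((m : ℝ) - 1))
        + (4 * ((m : ℝ) - ∑ k, P k j) - α / ((m : ℝ) - 1)) * P i j := by
  have hm' : (2 : ℝ) ≤ m := by exact_mod_cast hm
  have hne : (m : ℝ) - 1 ≠ 0 := by linarith
  rw [piAlpha, squ_two_of_sum_eq_one (hP i).2, squ_two_of_sum_eq_one (sum_avgExcept hm hP i),
    avgExcept_eq]
  field_simp
  ring

/-- For `n = 2` outcomes, holding fixed the reports of experts outside the coalition `C`,
the coalition's total reward under outcome `j` depends only on the sum `p_{C,j}` of the
coalition members' reported probabilities of outcome `j`. -/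
theorem coalition_reward_depends_only_on_sum (m : ℕ) (hm : 2 ≤ m) (α : ℝ)
    (C : Finset (Fin m)) (hC : 2 ≤ C.card) (j : Fin 2)
    (P Q : Fin m → Fin 2 → ℝ) (hP : IsSimplexTuple P) (hQ : IsSimplexTuple Q)
    (hout : ∀ i ∉ C, P i = Q i)
    (hsum : ∑ i ∈ C, P i j = ∑ i ∈ C, Q i j) :
    ∑ i ∈ C, piAlpha α P i j = ∑ i ∈ C, piAlpha α Q i j := by
  have hS : ∑ k, P k j = ∑ k, Q k j := by
    rw [← Finset.sum_compl_add_sum C, ← Finset.sum_compl_add_sum C, hsum]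
    congr 1
    exact Finset.sum_congr rfl fun k hk => by rw [hout k (Finset.mem_compl.mp hk)]
  simp only [piAlpha_two_eq hm α hP, piAlpha_two_eq hm α hQ, Finset.sum_add_distrib,
    ← Finset.mul_sum, hS, hsum]
end

section
/- Let m ≥ 2, n ≥ 2, α ≥ 2(m−1)²n, and let Π^α be the contract function Π^α_i(P; j) = s_qu(p_i; j) − (m−1)² s_qu(p̄_{−i}; j) + α p̄_{−i,j}. Let C ⊆ [m] be a coalition with |C| ≥ 2, and let P, Q ∈ (Δ_n)^m satisfy p_i = q_i for all i ∉ C. Let j̃ ∈ [n] be an index maximizing p_{C,ℓ} − q_{C,ℓ} over ℓ ∈ [n], and set ε = p_{C,j̃} − q_{C,j̃}. Then Σ_{i∈C} Π^α_i(Q; j̃) − Σ_{i∈C} Π^α_i(P; j̃) ≤ −2εn ≤ 0, with equality only if q_{C,ℓ} = p_{C,ℓ} for all ℓ ∈ [n]. -/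
open Finset

theorem squ_eq {n : ℕ} (p : Fin n → ℝ) (j : Fin n) :
    squ p j = 2 * p j - ∑ l, p l ^ 2 := by
  have h := Finset.sum_compl_add_sum ({j} : Finset (Fin n)) fun l => p l ^ 2
  rw [Finset.sum_singleton] at h
  rw [squ, ← h]
  ring

theorem sub_one_mul_avgExcept {m n : ℕ} (hm : (m : ℝ) - 1 ≠ 0) (P : Fin m → Fin n → ℝ)
    (i : Fin m) (j : Fin n) :
    ((m : ℝ) - 1) * avgExcept P i j = ∑ k, P k j - P i j := by
  have h := Finset.sum_compl_add_sum ({i} : Finset (Fin m)) fun k => P k j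
  rw [Finset.sum_singleton] at h
  rw [avgExcept, ← h]
  field_simp
  ring

theorem piAlpha_eq {m n : ℕ} (hm : (m : ℝ) - 1 ≠ 0) (α : ℝ) (P : Fin m → Fin n → ℝ)
    (i : Fin m) (j : Fin n) :
    piAlpha α P i j = 2 * P i j + ∑ l, ((∑ k, P k l) ^ 2 - 2 * (∑ k, P k l) * P i l)
      + (α / ((m : ℝ) - 1) - 2 * ((m : ℝ) - 1)) * (∑ k, P k j - P i j) := by
  have hsq : ((m : ℝ) - 1) ^ 2 * ∑ l, avgExcept P i l ^ 2
      = ∑ l, (∑ k, P k l - P i l) ^ 2 := by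
    rw [Finset.mul_sum]
    refine Finset.sum_congr rfl fun l _ => ?_
    rw [← sub_one_mul_avgExcept hm, mul_pow]
  have hexp : ∑ l, ((∑ k, P k l) ^ 2 - 2 * (∑ k, P k l) * P i l)
      = ∑ l, (∑ k, P k l - P i l) ^ 2 - ∑ l, P i l ^ 2 := by
    rw [← Finset.sum_sub_distrib]
    exact Finset.sum_congr rfl fun l _ => by ring
  rw [piAlpha, squ_eq, squ_eq, hexp, ← hsq, ← sub_one_mul_avgExcept hm]
  field_simp
  ring

/-- The total reward of a coalition depends only on its aggregate report and on that of the
remaining experts. -/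
theorem sum_piAlpha_eq {m n : ℕ} (hm : (m : ℝ) - 1 ≠ 0) (α : ℝ) (P : Fin m → Fin n → ℝ)
    (C : Finset (Fin m)) (j : Fin n) :
    ∑ i ∈ C, piAlpha α P i j = 2 * ∑ i ∈ C, P i j
      + ∑ l, ((C.card : ℝ) * (∑ k ∈ Cᶜ, P k l) ^ 2
        + (2 * C.card - 2) * (∑ k ∈ Cᶜ, P k l) * (∑ i ∈ C, P i l)
        + (C.card - 2) * (∑ i ∈ C, P i l) ^ 2)
      + (α / ((m : ℝ) - 1) - 2 * ((m : ℝ) - 1))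
        * (C.card * ∑ k ∈ Cᶜ, P k j + (C.card - 1) * ∑ i ∈ C, P i j) := by
  simp only [piAlpha_eq hm, Finset.sum_add_distrib (s := C), ← Finset.mul_sum]
  congr 1
  · congr 1
    rw [Finset.sum_comm]
    refine Finset.sum_congr rfl fun l _ => ?_
    rw [Finset.sum_sub_distrib, ← Finset.mul_sum, Finset.sum_const, nsmul_eq_mul,
      ← Finset.sum_compl_add_sum C fun k => P k l]
    ring
  · rw [Finset.sum_sub_distrib, Finset.sum_const, nsmul_eq_mul,
      ← Finset.sum_compl_add_sum C fun k => P k j]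
    ring

theorem IsSimplexTuple.sum_nonneg {m n : ℕ} {P : Fin m → Fin n → ℝ} (hP : IsSimplexTuple P)
    (S : Finset (Fin m)) (l : Fin n) : 0 ≤ ∑ i ∈ S, P i l :=
  Finset.sum_nonneg fun i _ => (hP i).1 l

theorem IsSimplexTuple.sum_sum {m n : ℕ} {P : Fin m → Fin n → ℝ} (hP : IsSimplexTuple P)
    (S : Finset (Fin m)) : ∑ l, ∑ i ∈ S, P i l = S.card := by
  rw [Finset.sum_comm, Finset.sum_congr rfl fun i _ => (hP i).2]
  simp

/-- If the entries of `d` sum to zero and are at most `ε`, none is below `-(n - 1) ε`. -/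
theorem neg_le_of_sum_eq_zero {n : ℕ} {d : Fin n → ℝ} {ε : ℝ} (hd : ∑ l, d l = 0)
    (hle : ∀ l, d l ≤ ε) (l : Fin n) : -d l ≤ ((n : ℝ) - 1) * ε := by
  have h := Finset.single_le_sum (f := fun k => ε - d k)
    (fun k _ => sub_nonneg.2 (hle k)) (Finset.mem_univ l)
  simp only [Finset.sum_sub_distrib, hd, Finset.sum_const, Finset.card_univ, Fintype.card_fin,
    nsmul_eq_mul] at h
  linarith

/-- **Case 2 (`α ≥ 2(m-1)²n`).** If a coalition `C` deviates from `P` to `Q` (agreeing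
outside `C`), then at an outcome `j̃` maximizing `p_{C,l} - q_{C,l}`, with
`ε = p_{C,j̃} - q_{C,j̃}`, the change in the coalition's total reward is at most `-2εn ≤ 0`,
with equality only if `q_{C,l} = p_{C,l}` for all `l`. -/
theorem coalition_deviation_large_alpha (m n : ℕ) (hm : 2 ≤ m) (hn : 2 ≤ n) (α : ℝ)
    (hα : 2 * ((m : ℝ) - 1) ^ 2 * (n : ℝ) ≤ α) (C : Finset (Fin m)) (hC : 2 ≤ C.card)
    (P Q : Fin m → Fin n → ℝ) (hP : IsSimplexTuple P) (hQ : IsSimplexTuple Q)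
    (hout : ∀ i ∉ C, P i = Q i) (jt : Fin n) (ε : ℝ)
    (hε : ε = (∑ i ∈ C, P i jt) - (∑ i ∈ C, Q i jt))
    (hjt : ∀ l, (∑ i ∈ C, P i l) - (∑ i ∈ C, Q i l) ≤ ε) :
    ((∑ i ∈ C, piAlpha α Q i jt) - ∑ i ∈ C, piAlpha α P i jt ≤ -2 * ε * n) ∧
    (-2 * ε * (n : ℝ) ≤ 0) ∧
    ((∑ i ∈ C, piAlpha α Q i jt) - (∑ i ∈ C, piAlpha α P i jt) = 0 →
      ∀ l, ∑ i ∈ C, Q i l = ∑ i ∈ C, P i l) := by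
  have hm' : (2 : ℝ) ≤ m := by exact_mod_cast hm
  have hn' : (2 : ℝ) ≤ n := by exact_mod_cast hn
  have hC' : (2 : ℝ) ≤ C.card := by exact_mod_cast hC
  have hm0 : 0 < (m : ℝ) - 1 := by linarith
  set x : Fin n → ℝ := fun l => ∑ i ∈ C, P i l with hx
  set y : Fin n → ℝ := fun l => ∑ i ∈ C, Q i l with hy
  set r : Fin n → ℝ := fun l => ∑ i ∈ Cᶜ, P i l with hr
  set c : ℝ := (C.card : ℝ) with hc
  set β : ℝ := α / ((m : ℝ) - 1) - 2 * ((m : ℝ) - 1) with hβ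
  have hrQ : ∀ l, ∑ i ∈ Cᶜ, Q i l = r l := fun l =>
    Finset.sum_congr rfl fun i hi => by rw [hout i (Finset.mem_compl.1 hi)]
  have hxs : ∑ l, x l = c := hP.sum_sum C
  have hys : ∑ l, y l = c := hQ.sum_sum C
  have hrs : ∑ l, r l = m - c := by
    have h := Finset.card_add_card_compl C
    rw [Fintype.card_fin] at h
    have h' : c + (Cᶜ.card : ℝ) = m := by rw [hc]; exact_mod_cast h
    rw [hP.sum_sum Cᶜ]
    linarith
  have hd : ∑ l, (x l - y l) = 0 := by rw [Finset.sum_sub_distrib, hxs, hys, sub_self]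
  have hlow := neg_le_of_sum_eq_zero hd hjt
  have hε0 : 0 ≤ ε := by
    have h1 := hlow jt
    have h2 : ε = x jt - y jt := hε
    nlinarith
  have hβ' : 2 * ((m : ℝ) - 1) * (n - 1) ≤ β := by
    have h : 2 * ((m : ℝ) - 1) * n ≤ α / ((m : ℝ) - 1) := by
      rw [le_div_iff₀ hm0]
      linarith
    rw [hβ]
    linarith
  set w : Fin n → ℝ := fun l => (2 * c - 2) * r l + (c - 2) * (x l + y l) with hw
  have hw0 : ∀ l, 0 ≤ w l := fun l => by
    have h1 := hP.sum_nonneg C l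
    have h2 := hQ.sum_nonneg C l
    have h3 := hP.sum_nonneg Cᶜ l
    exact add_nonneg (mul_nonneg (by linarith) h3)
      (mul_nonneg (by linarith) (add_nonneg h1 h2))
  have hws : ∑ l, w l = 2 * ((c - 1) * (m - 1) - 1) := by
    simp only [hw, Finset.sum_add_distrib, ← Finset.mul_sum, hxs, hys, hrs]
    ring
  have hbound : ∑ l, -(x l - y l) * w l
      ≤ ((n : ℝ) - 1) * ε * (2 * ((c - 1) * (m - 1) - 1)) := by
    rw [← hws, Finset.mul_sum]
    exact Finset.sum_le_sum fun l _ => mul_le_mul_of_nonneg_right (hlow l) (hw0 l)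
  have hchange : (∑ i ∈ C, piAlpha α Q i jt) - ∑ i ∈ C, piAlpha α P i jt
      = ∑ l, -(x l - y l) * w l - 2 * ε - (c - 1) * β * ε := by
    have hsum : ∑ l, -(x l - y l) * w l
        = ∑ l, (c * r l ^ 2 + (2 * c - 2) * r l * y l + (c - 2) * y l ^ 2)
          - ∑ l, (c * r l ^ 2 + (2 * c - 2) * r l * x l + (c - 2) * x l ^ 2) := by
      rw [← Finset.sum_sub_distrib]
      exact Finset.sum_congr rfl fun l _ => by simp only [hw]; ring
    rw [sum_piAlpha_eq hm0.ne', sum_piAlpha_eq hm0.ne', hsum, hε]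
    simp only [hrQ]
    ring
  have hmain : (∑ i ∈ C, piAlpha α Q i jt) - ∑ i ∈ C, piAlpha α P i jt ≤ -2 * ε * n := by
    rw [hchange]
    have h := mul_le_mul_of_nonneg_left hβ' (mul_nonneg (by linarith : 0 ≤ c - 1) hε0)
    linarith
  refine ⟨hmain, by nlinarith, fun heq l => ?_⟩
  have hεz : ε = 0 := by
    rw [heq] at hmain
    nlinarith
  have h1 := hjt l
  have h2 := hlow l
  rw [hεz] at h1 h2
  change y l = x l
  change x l - y l ≤ 0 at h1
  linarith
end
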